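/- Fix a positive integer r. For every real ε > 0 there exists a constant C = C(r, ε) such that for every positive integer K, the number J_r(K) of solutions (x₁, ..., x_{2r}) of positive integers with 1 ≤ x₁, ..., x_{2r} ≤ K of the equation 1/x₁ + ... + 1/x_r = 1/x_{r+1} + ... + 1/x_{2r} (in rational numbers) satisfies J_r(K) ≤ C K^{r + ε}. -/

import Mathlib

open Finset

/-- `J_r(K)`: the number of `2r`-tuples `(x₁, …, x_{2r})` of integers with
`1 ≤ x₁, …, x_{2r} ≤ K` satisfying `1/x₁ + ⋯ + 1/x_r = 1/x_{r+1} + ⋯ + 1/x_{2r}`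
(as rational numbers). The tuple is encoded as a pair of `r`-tuples. -/
noncomputable def reciprocalEqCount (r K : ℕ) : ℕ :=
  Set.ncard {p : (Fin r → ℕ) × (Fin r → ℕ) |
    (∀ i, 1 ≤ p.1 i ∧ p.1 i ≤ K) ∧ (∀ i, 1 ≤ p.2 i ∧ p.2 i ≤ K) ∧
    ∑ i, (1 : ℚ) / (p.1 i : ℚ) = ∑ i, (1 : ℚ) / (p.2 i : ℚ)}

theorem exists_card_divisors_le_rpow {δ : ℝ} (hδ : 0 < δ) :
    ∃ C : ℝ, 1 ≤ C ∧ ∀ n : ℕ, n ≠ 0 → (#n.divisors : ℝ) ≤ C * (n : ℝ) ^ δ := by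
  obtain ⟨B, hB⟩ := exists_nat_ge ((2 : ℝ) ^ δ⁻¹)
  set s : ℝ := 2 ^ δ - 1 with hs
  have hs0 : 0 < s := sub_pos.2 (Real.one_lt_rpow one_lt_two hδ)
  have hA : 1 ≤ 1 + s⁻¹ := by linarith [inv_pos.2 hs0]
  refine ⟨(1 + s⁻¹) ^ B, one_le_pow₀ hA, fun n hn => ?_⟩
  have hlocal : ∀ p ∈ n.primeFactors, ((n.factorization p + 1 : ℕ) : ℝ) ≤
      (if p < B then 1 + s⁻¹ else 1) * ((p : ℝ) ^ δ) ^ n.factorization p := by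
    intro p hp
    have hp2 : (2 : ℝ) ≤ p := by exact_mod_cast (Nat.prime_of_mem_primeFactors hp).two_le
    generalize n.factorization p = v
    split_ifs with hpB
    · have h1 : 1 + (v : ℝ) * s ≤ ((p : ℝ) ^ δ) ^ v :=
        calc 1 + (v : ℝ) * s ≤ (1 + s) ^ v := one_add_mul_le_pow (by linarith) v
          _ = ((2 : ℝ) ^ δ) ^ v := by rw [hs]; ring
          _ ≤ ((p : ℝ) ^ δ) ^ v := by gcongr
      calc ((v + 1 : ℕ) : ℝ) ≤ v + 1 + (s⁻¹ + v * s) := by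
            push_cast
            have : 0 ≤ s⁻¹ + v * s := by positivity
            linarith
        _ = (1 + s⁻¹) * (1 + v * s) := by field_simp; ring
        _ ≤ _ := by gcongr
    · have h2 : (2 : ℝ) ≤ (p : ℝ) ^ δ := by
        have : (2 : ℝ) ^ δ⁻¹ ≤ p := hB.trans (by exact_mod_cast not_lt.1 hpB)
        calc (2 : ℝ) = ((2 : ℝ) ^ δ⁻¹) ^ δ := by
              rw [← Real.rpow_mul zero_le_two, inv_mul_cancel₀ hδ.ne', Real.rpow_one]
          _ ≤ _ := by gcongr
      calc ((v + 1 : ℕ) : ℝ) ≤ 2 ^ v := by exact_mod_cast Nat.lt_two_pow_self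
        _ ≤ 1 * ((p : ℝ) ^ δ) ^ v := by rw [one_mul]; gcongr
  have hc : ∏ p ∈ n.primeFactors, (if p < B then 1 + s⁻¹ else 1) ≤ (1 + s⁻¹) ^ B := by
    rw [prod_ite, prod_const, prod_const_one, mul_one]
    refine pow_le_pow_right₀ hA ?_
    calc #(n.primeFactors.filter (· < B)) ≤ #(range B) :=
          card_le_card fun p hp => mem_range.2 (mem_filter.1 hp).2
      _ = B := card_range B
  have hn' : ∏ p ∈ n.primeFactors, ((p : ℝ) ^ δ) ^ n.factorization p = (n : ℝ) ^ δ := by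
    conv_rhs => rw [← Nat.prod_factorization_pow_eq_self hn]
    rw [Finsupp.prod, Nat.support_factorization, Nat.cast_prod,
      ← Real.finsetProd_rpow _ _ fun _ _ => by positivity]
    refine prod_congr rfl fun p _ => ?_
    rw [Nat.cast_pow, ← Real.rpow_natCast, ← Real.rpow_natCast, ← Real.rpow_mul (by positivity),
      ← Real.rpow_mul (by positivity), mul_comm]
  calc (#n.divisors : ℝ)
      = ∏ p ∈ n.primeFactors, ((n.factorization p + 1 : ℕ) : ℝ) := by
        rw [Nat.card_divisors hn, Nat.cast_prod]
    _ ≤ ∏ p ∈ n.primeFactors,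
          (if p < B then 1 + s⁻¹ else 1) * ((p : ℝ) ^ δ) ^ n.factorization p :=
        prod_le_prod (fun _ _ => by positivity) hlocal
    _ ≤ _ := by
        rw [prod_mul_distrib, hn']
        gcongr

/-- A powerful number lies between a square and a cube of the same integer, for divisibility. -/
theorem exists_sq_dvd_and_dvd_cube_of_powerful {n : ℕ} (hn : ∀ p, p.Prime → p ∣ n → p ^ 2 ∣ n) :
    ∃ m, m ^ 2 ∣ n ∧ n ∣ m ^ 3 := by
  obtain ⟨a, b, rfl, ha⟩ := Nat.sq_mul_squarefree n
  refine ⟨b, dvd_mul_right _ _, ?_⟩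
  suffices a ∣ b by rw [pow_succ b 2]; exact mul_dvd_mul_left _ this
  rw [← Nat.prod_primeFactors_of_squarefree ha]
  refine prod_primes_dvd b (fun p hp => (Nat.prime_of_mem_primeFactors hp).prime) fun p hp => ?_
  have hp' := Nat.prime_of_mem_primeFactors hp
  have hsq := hn p hp' ((Nat.dvd_of_mem_primeFactors hp).mul_left _)
  by_contra hpb
  have hcop : Nat.Coprime (p ^ 2) (b ^ 2) := ((Nat.Prime.coprime_iff_not_dvd hp').2 hpb).pow 2 2
  have := hcop.dvd_of_dvd_mul_left hsq
  exact hp'.one_lt.ne' (Nat.isUnit_iff.1 (ha p (by rwa [← sq])))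

/-- If a signed sum of reciprocals vanishes, the product of the denominators is powerful. -/
theorem sq_dvd_prod_of_sum_div_eq_zero {ι : Type*} [Fintype ι] [DecidableEq ι] {x : ι → ℕ}
    (hx : ∀ i, x i ≠ 0) {c : ι → ℤ} (hc : ∀ i, IsUnit (c i))
    (hsum : ∑ i, (c i : ℚ) / (x i : ℚ) = 0) {p : ℕ} (hp : p.Prime) (hdvd : p ∣ ∏ i, x i) :
    p ^ 2 ∣ ∏ i, x i := by
  obtain ⟨i, -, hi⟩ := (hp.prime.dvd_finsetProd_iff _).1 hdvd
  have hclear : ∑ j, c j * ∏ k ∈ univ.erase j, (x k : ℤ) = 0 := by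
    have : ∑ j, (c j : ℚ) * ∏ k ∈ univ.erase j, (x k : ℚ) = 0 := by
      rw [← zero_mul (∏ k, (x k : ℚ)), ← hsum, sum_mul]
      refine sum_congr rfl fun j _ => ?_
      have := hx j
      rw [← mul_prod_erase univ (fun k => (x k : ℚ)) (mem_univ j)]
      field_simp
    exact_mod_cast this
  rw [← add_sum_erase _ _ (mem_univ i)] at hclear
  have hrest : (p : ℤ) ∣ ∑ j ∈ univ.erase i, c j * ∏ k ∈ univ.erase j, (x k : ℤ) := by
    refine dvd_sum fun j hj => Dvd.dvd.mul_left ?_ _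
    exact (Int.natCast_dvd_natCast.2 hi).trans
      (dvd_prod_of_mem (fun k => (x k : ℤ)) (mem_erase.2 ⟨(ne_of_mem_erase hj).symm, mem_univ i⟩))
  have hprod : p ∣ ∏ k ∈ univ.erase i, x k := by
    have h := (dvd_add_left hrest).1 (hclear ▸ dvd_zero (p : ℤ))
    rw [(hc i).dvd_mul_left] at h
    exact_mod_cast h
  rw [← mul_prod_erase univ x (mem_univ i), sq]
  exact mul_dvd_mul hi hprod

theorem exists_le_pow_and_dvd_cube_of_sum_one_div_eq {r K : ℕ} {x y : Fin r → ℕ}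
    (hx : ∀ i, 1 ≤ x i ∧ x i ≤ K) (hy : ∀ i, 1 ≤ y i ∧ y i ≤ K)
    (h : ∑ i, (1 : ℚ) / (x i : ℚ) = ∑ i, (1 : ℚ) / (y i : ℚ)) :
    ∃ m ∈ Icc 1 (K ^ r), (∀ i, x i ∣ m ^ 3) ∧ ∀ i, y i ∣ m ^ 3 := by
  have hz : ∀ i, Sum.elim x y i ≠ 0 ∧ Sum.elim x y i ≤ K := by
    rintro (i | i)
    · exact ⟨Nat.one_le_iff_ne_zero.1 (hx i).1, (hx i).2⟩
    · exact ⟨Nat.one_le_iff_ne_zero.1 (hy i).1, (hy i).2⟩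
  have hpowerful : ∀ p, p.Prime → p ∣ ∏ i, Sum.elim x y i → p ^ 2 ∣ ∏ i, Sum.elim x y i :=
    fun p hp => sq_dvd_prod_of_sum_div_eq_zero (fun i => (hz i).1)
      (c := Sum.elim (fun _ => 1) fun _ => -1)
      (by rintro (i | i) <;> simp) (by
        simp only [Fintype.sum_sum_type, Sum.elim_inl, Sum.elim_inr, Int.cast_one, Int.cast_neg,
          neg_div, sum_neg_distrib]
        rw [h, add_neg_cancel]) hp
  obtain ⟨m, hm2, hm3⟩ := exists_sq_dvd_and_dvd_cube_of_powerful hpowerful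
  have hne : ∏ i, Sum.elim x y i ≠ 0 := prod_ne_zero_iff.2 fun i _ => (hz i).1
  have hm0 : m ≠ 0 := by rintro rfl; exact hne (by simpa using hm2)
  have hle : m ^ 2 ≤ (K ^ r) ^ 2 :=
    calc m ^ 2 ≤ ∏ i, Sum.elim x y i := Nat.le_of_dvd (Nat.pos_of_ne_zero hne) hm2
      _ ≤ ∏ _i : Fin r ⊕ Fin r, K := prod_le_prod' fun i _ => (hz i).2
      _ = (K ^ r) ^ 2 := by simp [← pow_mul, mul_two]
  exact ⟨m, mem_Icc.2 ⟨Nat.one_le_iff_ne_zero.2 hm0, (Nat.pow_le_pow_iff_left two_ne_zero).1 hle⟩,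
    fun i => (dvd_prod_of_mem (Sum.elim x y) (mem_univ (Sum.inl i))).trans hm3,
    fun i => (dvd_prod_of_mem (Sum.elim x y) (mem_univ (Sum.inr i))).trans hm3⟩

theorem reciprocalEqCount_le_sum (r K : ℕ) :
    reciprocalEqCount r K ≤ ∑ m ∈ Icc 1 (K ^ r), #(m ^ 3).divisors ^ (2 * r) := by
  classical
  let D : ℕ → Finset (Fin r → ℕ) := fun m => Fintype.piFinset fun _ => (m ^ 3).divisors
  calc reciprocalEqCount r K ≤ #((Icc 1 (K ^ r)).biUnion fun m => D m ×ˢ D m) := by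
        rw [← Set.ncard_coe_finset]
        refine Set.ncard_le_ncard ?_ (finite_toSet _)
        rintro ⟨x, y⟩ ⟨hx, hy, h⟩
        obtain ⟨m, hm, hxm, hym⟩ := exists_le_pow_and_dvd_cube_of_sum_one_div_eq hx hy h
        have hm0 : m ≠ 0 := Nat.one_le_iff_ne_zero.1 (mem_Icc.1 hm).1
        refine mem_coe.2 (mem_biUnion.2 ⟨m, hm, mem_product.2 ⟨?_, ?_⟩⟩) <;>
          refine Fintype.mem_piFinset.2 fun i => Nat.mem_divisors.2 ⟨?_, pow_ne_zero 3 hm0⟩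
        exacts [hxm i, hym i]
    _ ≤ ∑ m ∈ Icc 1 (K ^ r), #(D m ×ˢ D m) := card_biUnion_le
    _ = _ := by simp [D, two_mul, pow_add]

/-- Lemma (Karatsuba): fix a positive integer `r`. For every `ε > 0` there is a constant
`C = C(r, ε)` such that `J_r(K) ≤ C K^{r+ε}` for every positive integer `K`. -/
theorem reciprocal_equation_count_bound (r : ℕ) (hr : 1 ≤ r) (ε : ℝ) (hε : 0 < ε) :
    ∃ C : ℝ, ∀ K : ℕ, 1 ≤ K →
      (reciprocalEqCount r K : ℝ) ≤ C * (K : ℝ) ^ ((r : ℝ) + ε) := by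
  have hr0 : (r : ℝ) ≠ 0 := by positivity
  obtain ⟨C, hC1, hC⟩ := exists_card_divisors_le_rpow (δ := ε / (6 * r ^ 2)) (by positivity)
  refine ⟨C ^ (2 * r), fun K hK => ?_⟩
  have hK0 : (0 : ℝ) < K := by exact_mod_cast hK
  have hterm : ∀ m ∈ Icc 1 (K ^ r),
      (#(m ^ 3).divisors : ℝ) ^ (2 * r) ≤ C ^ (2 * r) * (K : ℝ) ^ ε := by
    intro m hm
    obtain ⟨hm1, hmK⟩ := mem_Icc.1 hm
    have hle : ((m ^ 3 : ℕ) : ℝ) ≤ (K : ℝ) ^ (r * 3) := by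
      rw [pow_mul]; exact_mod_cast Nat.pow_le_pow_left hmK 3
    calc (#(m ^ 3).divisors : ℝ) ^ (2 * r)
        ≤ (C * ((m ^ 3 : ℕ) : ℝ) ^ (ε / (6 * r ^ 2))) ^ (2 * r) := by
          gcongr; exact hC _ (by positivity)
      _ ≤ (C * ((K : ℝ) ^ (r * 3)) ^ (ε / (6 * r ^ 2))) ^ (2 * r) := by gcongr
      _ = C ^ (2 * r) * (K : ℝ) ^ ε := by
          rw [mul_pow, ← Real.rpow_natCast (K : ℝ), ← Real.rpow_mul hK0.le,
            ← Real.rpow_mul_natCast hK0.le]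
          congr 2
          push_cast
          field_simp
          norm_num
  calc (reciprocalEqCount r K : ℝ)
      ≤ ∑ m ∈ Icc 1 (K ^ r), (#(m ^ 3).divisors : ℝ) ^ (2 * r) := by
        exact_mod_cast reciprocalEqCount_le_sum r K
    _ ≤ #(Icc 1 (K ^ r)) • (C ^ (2 * r) * (K : ℝ) ^ ε) := sum_le_card_nsmul _ _ _ hterm
    _ = C ^ (2 * r) * (K : ℝ) ^ ((r : ℝ) + ε) := by
        rw [Nat.card_Icc, Nat.add_sub_cancel, nsmul_eq_mul, Real.rpow_add hK0, Real.rpow_natCast]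
        push_cast
        ring
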